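/- There is a unique map D from SL(2, ℤ/Nℤ) to the invertible I×I complex matrices such that ρ = D ∘ μ_N, where μ_N : SL(2,ℤ) → SL(2,ℤ/Nℤ) is reduction modulo N. Moreover D is a group homomorphism, every entry of every D(g) lies in ℚ(ζ_N), and for every integer l coprime to N and every g = [[a,b],[c,d]] ∈ SL(2,ℤ/Nℤ) one has σ̄_l(D(g)) = D(τ_l(g)), where τ_l(g) = [[a, l·b],[l̂·c, d]] ∈ SL(2,ℤ/Nℤ), l̂ is the inverse of l in ℤ/Nℤ, and σ̄_l is the automorphism of ℚ(ζ_N) with σ̄_l(ζ_N) = ζ_N^l, applied entrywise. -/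

import Mathlib

open Matrix Complex

abbrev SL2Z := Matrix.SpecialLinearGroup (Fin 2) ℤ

def sM : SL2Z := ⟨!![0, -1; 1, 0], by norm_num [Matrix.det_fin_two_of]⟩
def tM : SL2Z := ⟨!![1, 1; 0, 1], by norm_num [Matrix.det_fin_two_of]⟩

theorem exists_isCoprime_add_mul {x y m : ℤ} (hm : m ≠ 0)
    (h : ∀ p : ℤ, Prime p → p ∣ m → p ∣ x → ¬ p ∣ y) : ∃ k, IsCoprime (x + k * y) m := by
  let ps : Finset ℕ := {p ∈ m.natAbs.primeFactors | ¬ (p : ℤ) ∣ x}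
  refine ⟨∏ p ∈ ps, (p : ℤ), isCoprime_of_prime_dvd (fun h0 ↦ hm h0.2) fun z hz hzx hzm ↦ ?_⟩
  by_cases hx : z ∣ x
  · obtain h1 | h1 := hz.dvd_or_dvd ((Int.dvd_add_right hx).1 hzx)
    · obtain ⟨q, hq, hzq⟩ := (hz.dvd_finsetProd_iff _).1 h1
      rw [Finset.mem_filter, Nat.mem_primeFactors] at hq
      refine hq.2 (Dvd.dvd.trans ?_ hx)
      exact ((hz.associated_of_dvd (Nat.prime_iff_prime_int.1 hq.1.1) hzq).symm).dvd
    · exact h z hz hzm hx h1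
  · have hmem : z.natAbs ∈ ps := by
      simp only [ps, Finset.mem_filter, Nat.mem_primeFactors, Int.natCast_natAbs, abs_dvd]
      exact ⟨⟨Int.prime_iff_natAbs_prime.1 hz, Int.natAbs_dvd_natAbs.2 hzm, by simpa⟩, hx⟩
    have hdvd : z ∣ ∏ p ∈ ps, (p : ℤ) :=
      (by simp : z ∣ (z.natAbs : ℤ)).trans (Finset.dvd_prod_of_mem (fun p : ℕ ↦ (p : ℤ)) hmem)
    exact hx ((Int.dvd_add_left (hdvd.mul_right y)).1 hzx)

theorem specialLinearGroup_map_intCast_surjective {N : ℕ} (hN : 0 < N) :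
    Function.Surjective (SpecialLinearGroup.map (n := Fin 2) (Int.castRingHom (ZMod N))) := by
  intro g
  obtain ⟨a, ha⟩ := ZMod.intCast_surjective (g 0 0)
  obtain ⟨b, hb⟩ := ZMod.intCast_surjective (g 0 1)
  obtain ⟨d₀, hd₀⟩ := ZMod.intCast_surjective (g 1 1)
  obtain ⟨c, hc0, hc⟩ : ∃ c : ℤ, c ≠ 0 ∧ (c : ZMod N) = g 1 0 := by
    obtain ⟨c, hc⟩ := ZMod.intCast_surjective (g 1 0)
    by_cases h : c = 0
    · exact ⟨N, by omega, by simp [← hc, h]⟩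
    · exact ⟨c, h, hc⟩
  have hdet := g.det_coe
  rw [det_fin_two, ← ha, ← hb, ← hc, ← hd₀] at hdet
  have hdvd (d : ℤ) (hd : (d : ZMod N) = d₀) : (N : ℤ) ∣ a * d - b * c - 1 := by
    rw [← ZMod.intCast_zmod_eq_zero_iff_dvd]
    push_cast
    rw [hd, hdet, sub_self]
  obtain ⟨k, hk⟩ : ∃ k, IsCoprime (d₀ + k * N) c := by
    refine exists_isCoprime_add_mul hc0 fun p hp hpc hpd hpN ↦ hp.not_dvd_one ?_
    have := (dvd_sub (dvd_sub (hpd.mul_left a) (hpc.mul_left b)) (hpN.trans (hdvd d₀ rfl)))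
    simpa using this
  set d := d₀ + k * N with hd
  have hdcast : (d : ZMod N) = d₀ := by simp [hd]
  obtain ⟨r, hr⟩ := hdvd d hdcast
  obtain ⟨u, v, huv⟩ := hk
  refine ⟨⟨!![a - r * N * u, b + r * N * v; c, d], ?_⟩, ?_⟩
  · rw [det_fin_two_of]
    linear_combination hr - r * N * huv
  · ext i j
    change ((!![a - r * N * u, b + r * N * v; c, d] i j : ℤ) : ZMod N) = g i j
    fin_cases i <;> fin_cases j <;> simp [ha, hb, hc, hdcast, hd₀]

theorem exists_ringHom_extending_of_injective {A L M : Type*} [CommRing A] [IsDomain A] [Field L]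
    [Field M] [IsAlgClosed M] [Algebra A L] [FaithfulSMul A L] [Algebra.IsAlgebraic A L]
    {f : A →+* M} (hf : Function.Injective f) :
    ∃ τ : L →+* M, ∀ a, τ (algebraMap A L a) = f a := by
  let := f.toAlgebra
  have : FaithfulSMul A M := (faithfulSMul_iff_algebraMap_injective A M).2 hf
  exact ⟨(IsAlgClosed.lift : L →ₐ[A] M).toRingHom, (IsAlgClosed.lift : L →ₐ[A] M).commutes⟩

theorem exists_ringHom_extending {K L : Type*} [Field K] [Field L] [Algebra K L] [IsAlgClosed L]
    (σ : K →+* K) : ∃ τ : L →+* L, ∀ k, τ (algebraMap K L k) = algebraMap K L (σ k) := by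
  obtain ⟨s, hs⟩ := exists_isTranscendenceBasis K L
  let A := Algebra.adjoin K (Set.range ((↑) : s → L))
  let j : A →+* L := ((MvPolynomial.aeval ((↑) : s → L)).toRingHom.comp
    (MvPolynomial.map σ)).comp (hs.1.aevalEquiv.symm.toRingEquiv.toRingHom)
  have hj : Function.Injective j :=
    (Function.Injective.comp (g := MvPolynomial.aeval ((↑) : s → L)) hs.1
      (MvPolynomial.map_injective σ σ.injective)).comp hs.1.aevalEquiv.symm.injective
  have : Algebra.IsAlgebraic A L := hs.isAlgebraic
  obtain ⟨τ, hτ⟩ := exists_ringHom_extending_of_injective (L := L) hj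
  refine ⟨τ, fun k ↦ ?_⟩
  have h := hτ (algebraMap K A k)
  rw [← IsScalarTower.algebraMap_apply] at h
  rw [h]
  have h2 : hs.1.aevalEquiv.symm (algebraMap K A k) = MvPolynomial.C k :=
    hs.1.aevalEquiv.symm.commutes k
  simp only [j, RingHom.comp_apply]
  erw [h2]
  simp

theorem IsPrimitiveRoot.exists_ringHom_map_eq_zpow {n : ℕ} (hn : 0 < n) {L : Type*} [Field L]
    [CharZero L] [IsAlgClosed L] {ζ : L} (hζ : IsPrimitiveRoot ζ n) {d : ℤ}
    (hd : IsCoprime d (n : ℤ)) : ∃ σ : L →+* L, σ ζ = ζ ^ d := by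
  set K := IntermediateField.adjoin ℚ {ζ}
  let z : K := IntermediateField.AdjoinSimple.gen ℚ ζ
  have hz : IsPrimitiveRoot z n :=
    IsPrimitiveRoot.of_map_of_injective (f := algebraMap K L) hζ (algebraMap K L).injective
  have hzd := hz.zpow_of_gcd_eq_one d (Int.isCoprime_iff_gcd_eq_one.1 hd)
  have hroot : z ^ d ∈ (minpoly ℚ ζ).aroots K := by
    rw [← Polynomial.cyclotomic_eq_minpoly_rat hζ hn, Polynomial.mem_aroots]
    refine ⟨Polynomial.cyclotomic_ne_zero n ℚ, ?_⟩
    rw [Polynomial.aeval_def, Polynomial.eval₂_eq_eval_map, Polynomial.map_cyclotomic]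
    exact hzd.isRoot_cyclotomic hn
  let φ : K →ₐ[ℚ] K := (IntermediateField.algHomAdjoinIntegralEquiv ℚ
    (hζ.isIntegral hn).tower_top).symm ⟨_, hroot⟩
  have hφ : φ z = z ^ d := IntermediateField.algHomAdjoinIntegralEquiv_symm_apply_gen ..
  obtain ⟨τ, hτ⟩ := exists_ringHom_extending (L := L) (φ : K →+* K)
  refine ⟨τ, ?_⟩
  have := hτ z
  simpa [hφ, z] using this

theorem RingHom.map_eq_map_of_mem_adjoin_singleton {L : Type*} [Field L] [CharZero L] {σ τ : L →+* L}
    {ζ : L} (h : σ ζ = τ ζ) {x : L} (hx : x ∈ IntermediateField.adjoin ℚ {ζ}) : σ x = τ x := by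
  induction hx using IntermediateField.adjoin_induction with
  | mem x hx => simp_all
  | algebraMap x => simp
  | add x y _ _ hx hy => simp [hx, hy]
  | inv x _ hx => simp [hx]
  | mul x y _ _ hx hy => simp [hx, hy]

/-- Conjugation by `diag(u, 1)`. -/
def diagConj {R : Type*} [CommRing R] {u v : R} (huv : u * v = 1) :
    SpecialLinearGroup (Fin 2) R →* SpecialLinearGroup (Fin 2) R where
  toFun g := ⟨!![g 0 0, u * g 0 1; v * g 1 0, g 1 1], by
    have h := g.det_coe
    rw [det_fin_two] at h
    rw [det_fin_two_of]
    linear_combination h - g 0 1 * g 1 0 * huv⟩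
  map_one' := by ext i j; fin_cases i <;> fin_cases j <;> simp
  map_mul' g h := by
    refine Subtype.ext ?_
    change !![(g.1 * h.1) 0 0, u * (g.1 * h.1) 0 1; v * (g.1 * h.1) 1 0, (g.1 * h.1) 1 1] =
      !![g 0 0, u * g 0 1; v * g 1 0, g 1 1] * !![h 0 0, u * h 0 1; v * h 1 0, h 1 1]
    rw [mul_fin_two]
    ext i j
    fin_cases i <;> fin_cases j <;> simp [Matrix.mul_apply, Fin.sum_univ_two]
    · linear_combination -g 0 1 * h 1 0 * huv
    · ring
    · ring
    · linear_combination -g 1 0 * h 0 1 * huv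

theorem stmt15
    {I : Type} [Fintype I] [DecidableEq I] [Nonempty I] (i0 : I)
    (ρ : SL2Z →* (Matrix I I ℂ)ˣ)
    (S T : Matrix I I ℂ)
    (hSdef : S = (↑(ρ sM) : Matrix I I ℂ)) (hTdef : T = (↑(ρ tM) : Matrix I I ℂ))
    (n N : ℕ) (hn : 0 < n) (hNpos : 0 < N) (hNdvd : N ∣ n)
    (hTdiag : T.IsDiag) (hTord : orderOf T = N)
    (hSsymm : S.IsSymm) (hSunit : Sᴴ * S = 1)
    (ζ : ℂ) (hζ : ζ = Complex.exp (2 * Real.pi * Complex.I / n))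
    (hSfield : ∀ p q, S p q ∈ IntermediateField.adjoin ℚ {ζ})
    (perm : ℤ → Equiv.Perm I) (ε : ℤ → I → ℂ) (G : ℤ → Matrix I I ℂ)
    (hε : ∀ l : ℤ, IsCoprime l (n : ℤ) → ∀ p, ε l p = 1 ∨ ε l p = -1)
    (hG : ∀ (l : ℤ) (p q : I), G l p q = ε l q * (if p = perm l q then 1 else 0))
    (hGal : ∀ l : ℤ, IsCoprime l (n : ℤ) → ∀ σ : ℂ →+* ℂ, σ ζ = ζ ^ l →
      S.map σ = S * G l ∧ G l * S.map σ = S)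
    (hGT : ∀ l : ℤ, IsCoprime l (n : ℤ) → (G l)⁻¹ * T * G l = T ^ (l ^ 2 : ℤ))
    (hFor : ∀ (a b cc d : ℤ) (hdet : a * d - b * cc = 1), IsCoprime d (n : ℤ) →
      ∀ σ : ℂ →+* ℂ, σ ζ = ζ ^ d →
        ((↑(ρ ⟨!![a, b; cc, d], by rw [Matrix.det_fin_two_of]; linarith⟩) : Matrix I I ℂ)).map σ =
          T ^ b * S⁻¹ * T ^ (-cc) * S.map σ)
    (ζN : ℂ) (hζN : ζN = Complex.exp (2 * Real.pi * Complex.I / N))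
    (hSN : ∀ p q, S p q ∈ IntermediateField.adjoin ℚ {ζN})
    :
    ∃ D : Matrix.SpecialLinearGroup (Fin 2) (ZMod N) → (Matrix I I ℂ)ˣ,
      (∀ m : SL2Z, D (Matrix.SpecialLinearGroup.map (Int.castRingHom (ZMod N)) m) = ρ m) ∧
      (∀ D' : Matrix.SpecialLinearGroup (Fin 2) (ZMod N) → (Matrix I I ℂ)ˣ,
        (∀ m : SL2Z, D' (Matrix.SpecialLinearGroup.map (Int.castRingHom (ZMod N)) m) = ρ m) →
        D' = D) ∧
      (∀ g h, D (g * h) = D g * D h) ∧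
      (∀ g p q, (↑(D g) : Matrix I I ℂ) p q ∈ IntermediateField.adjoin ℚ {ζN}) ∧
      (∀ l : ℤ, IsCoprime l (N : ℤ) → ∀ lhat : ZMod N, (l : ZMod N) * lhat = 1 →
        ∀ σ : ℂ →+* ℂ, σ ζN = ζN ^ l →
        ∀ g h : Matrix.SpecialLinearGroup (Fin 2) (ZMod N),
          h 0 0 = g 0 0 → h 0 1 = (l : ZMod N) * g 0 1 →
          h 1 0 = lhat * g 1 0 → h 1 1 = g 1 1 →
          (↑(D g) : Matrix I I ℂ).map σ = (↑(D h) : Matrix I I ℂ)) := by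
  have hζp : IsPrimitiveRoot ζ n := hζ ▸ Complex.isPrimitiveRoot_exp n hn.ne'
  have hζNp : IsPrimitiveRoot ζN N := hζN ▸ Complex.isPrimitiveRoot_exp N hNpos.ne'
  have hζpow : ζ ^ (n / N) = ζN := by
    obtain ⟨k, rfl⟩ := hNdvd
    have hk : (k : ℂ) ≠ 0 := by rintro h; simp_all
    have hN0 : (N : ℂ) ≠ 0 := by exact_mod_cast hNpos.ne'
    rw [Nat.mul_div_cancel_left k hNpos, hζ, hζN, ← Complex.exp_nat_mul]
    congr 1
    push_cast
    field_simp
  have hmapN (σ : ℂ →+* ℂ) (d : ℤ) (hσ : σ ζ = ζ ^ d) : σ ζN = ζN ^ d := by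
    rw [← hζpow, map_pow, hσ, ← zpow_natCast, ← zpow_natCast, ← _root_.zpow_mul, ← _root_.zpow_mul,
      mul_comm]
  have hTN : ρ tM ^ N = 1 := by
    ext1
    rw [Units.val_pow_eq_pow_val, ← hTdef, ← hTord, pow_orderOf_eq_one, Units.val_one]
  have hTz (k : ℤ) : T ^ k = ↑(ρ tM ^ k) := by rw [hTdef, coe_units_zpow]
  have hUzN (k : ℤ) (hk : (N : ℤ) ∣ k) : ρ tM ^ k = 1 := by
    obtain ⟨r, rfl⟩ := hk
    rw [_root_.zpow_mul, zpow_natCast, hTN, _root_.one_zpow]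
  have hTzN (k : ℤ) (hk : (N : ℤ) ∣ k) : T ^ k = 1 := by rw [hTz, hUzN k hk, Units.val_one]
  have hSS : S⁻¹ * S = 1 := by
    rw [hSdef, ← coe_units_inv, Units.inv_mul]
  have hFor' (m : SL2Z) (h01 : (N : ℤ) ∣ m 0 1) (h10 : (N : ℤ) ∣ m 1 0)
      (hm : IsCoprime (m 1 1) (n : ℤ)) (σ : ℂ →+* ℂ) (hσ : σ ζ = ζ ^ m 1 1) :
      (ρ m : Matrix I I ℂ).map σ = S⁻¹ * S.map σ := by
    have hdet := m.det_coe
    rw [det_fin_two] at hdet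
    have h := hFor (m 0 0) (m 0 1) (m 1 0) (m 1 1) hdet hm σ hσ
    rw [hTzN _ h01, hTzN _ (dvd_neg.2 h10), one_mul, mul_one] at h
    rw [← h]
    congr 3
    exact Subtype.ext (eta_fin_two m.1)
  have hmap_inj (σ : ℂ →+* ℂ) {A B : Matrix I I ℂ} (h : A.map σ = B.map σ) : A = B :=
    Matrix.map_injective σ.injective h
  have htz (k : ℤ) : (tM ^ k : SL2Z).1 = !![1, k; 0, 1] := ModularGroup.coe_T_zpow k
  let f : SL2Z →* SpecialLinearGroup (Fin 2) (ZMod N) :=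
    SpecialLinearGroup.map (Int.castRingHom (ZMod N))
  have hf (m : SL2Z) (i j : Fin 2) : f m i j = (m i j : ZMod N) := rfl
  have hfs : Function.Surjective f := specialLinearGroup_map_intCast_surjective hNpos
  have hker : f.ker ≤ ρ.ker := by
    intro m hm
    rw [MonoidHom.mem_ker] at hm ⊢
    have hdet := m.det_coe
    rw [det_fin_two] at hdet
    have h01 : (N : ℤ) ∣ m 0 1 := by
      rw [← ZMod.intCast_zmod_eq_zero_iff_dvd, ← hf, hm]; rfl
    have h10 : (N : ℤ) ∣ m 1 0 := by
      rw [← ZMod.intCast_zmod_eq_zero_iff_dvd, ← hf, hm]; rfl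
    have h11 : (N : ℤ) ∣ m 1 1 - 1 := by
      rw [← ZMod.intCast_zmod_eq_zero_iff_dvd, Int.cast_sub, ← hf, hm]
      exact sub_eq_zero.2 Int.cast_one.symm
    obtain ⟨k, hk⟩ : ∃ k, IsCoprime (m 1 1 + k * (m 1 0 * N)) (n : ℤ) := by
      refine exists_isCoprime_add_mul (by exact_mod_cast hn.ne') fun p hp _ hpd hpy ↦
        hp.not_dvd_one ?_
      obtain h | h := hp.dvd_or_dvd hpy
      · rw [← hdet]
        exact dvd_sub (hpd.mul_left _) (h.mul_left _)
      · simpa using dvd_sub hpd (h.trans h11)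
    obtain ⟨m', hm'⟩ : ∃ m', m' = m * tM ^ (k * N) := ⟨_, rfl⟩
    have hρ : ρ m' = ρ m := by
      rw [hm', map_mul, map_zpow, hUzN _ (dvd_mul_left _ _), mul_one]
    have hent : m'.1 = m.1 * !![1, k * N; 0, 1] := by rw [hm', ← htz]; rfl
    have e01 : m' 0 1 = m 0 0 * (k * N) + m 0 1 := by
      rw [hent]; simp [Matrix.mul_apply, Fin.sum_univ_two]
    have e10 : m' 1 0 = m 1 0 := by
      rw [hent]; simp [Matrix.mul_apply, Fin.sum_univ_two]
    have e11 : m' 1 1 = m 1 1 + k * (m 1 0 * N) := by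
      rw [hent]; simp [Matrix.mul_apply, Fin.sum_univ_two]; ring
    have hcop : IsCoprime (m' 1 1) (n : ℤ) := e11 ▸ hk
    have h11' : (N : ℤ) ∣ m' 1 1 - 1 := by
      rw [e11, add_sub_right_comm]
      exact dvd_add h11 ((dvd_mul_left _ _).mul_left _)
    obtain ⟨σ, hσ⟩ := hζp.exists_ringHom_map_eq_zpow hn hcop
    have hσN : σ ζN = RingHom.id ℂ ζN := by
      rw [hmapN σ _ hσ, RingHom.id_apply]
      obtain ⟨r, hr⟩ := h11'
      rw [sub_eq_iff_eq_add.1 hr, zpow_add₀ (hζNp.ne_zero hNpos.ne'), _root_.zpow_mul, zpow_natCast,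
        hζNp.pow_eq_one, _root_.one_zpow, one_mul, zpow_one]
    have hSσ : S.map σ = S := by
      ext p q
      exact RingHom.map_eq_map_of_mem_adjoin_singleton hσN (hSN p q)
    have h := hFor' m' (e01 ▸ dvd_add ((dvd_mul_left _ _).mul_left _) h01) (e10 ▸ h10) hcop σ hσ
    rw [hSσ, hSS, hρ] at h
    ext1
    refine hmap_inj σ (h.trans ?_)
    rw [Units.val_one, Matrix.map_one _ (map_zero σ) (map_one σ)]
  have hgen : Subgroup.closure {sM, tM} = (⊤ : Subgroup SL2Z) := SpecialLinearGroup.SL2Z_generators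
  let D := f.liftOfSurjective hfs ⟨ρ, hker⟩
  have hD (m : SL2Z) : D (f m) = ρ m := MonoidHom.liftOfRightInverse_comp_apply ..
  have hTdiag' : T = diagonal fun p ↦ T p p := hTdiag.diagonal_diag.symm
  have hTroot (p : I) : T p p ^ N = 1 := by
    have h : T ^ N = 1 := by rw [← hTord, pow_orderOf_eq_one]
    rw [hTdiag', diagonal_pow] at h
    simpa using congr_fun (congr_fun h p) p
  have := NeZero.mk hNpos.ne'
  have := NeZero.mk hn.ne'
  refine ⟨D, hD, fun D' hD' ↦ ?_, map_mul D, ?_, ?_⟩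
  · ext1 g
    obtain ⟨m, rfl⟩ := hfs g
    exact (hD' m).trans (hD m).symm
  · let V : Submonoid (Matrix I I ℂ) :=
      (IntermediateField.adjoin ℚ {ζN}).toSubring.matrix.toSubmonoid
    have hle : Subgroup.closure {f sM, f tM} = ⊤ := by
      rw [← Set.image_pair, ← MonoidHom.map_closure, hgen, Subgroup.map_top_of_surjective f hfs]
    have hle' : Submonoid.closure {f sM, f tM} ≤ V.comap ((Units.coeHom _).comp D) := by
      rw [Submonoid.closure_le]
      rintro x (rfl | rfl)
      · change ∀ p q, (D (f sM) : Matrix I I ℂ) p q ∈ IntermediateField.adjoin ℚ {ζN}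
        rwa [hD, ← hSdef]
      · change ∀ p q, (D (f tM) : Matrix I I ℂ) p q ∈ IntermediateField.adjoin ℚ {ζN}
        rw [hD, ← hTdef]
        intro p q
        rw [hTdiag', diagonal_apply]
        split_ifs
        · obtain ⟨i, -, hi⟩ := hζNp.eq_pow_of_pow_eq_one (hTroot p)
          rw [← hi]
          exact pow_mem (IntermediateField.mem_adjoin_simple_self ℚ ζN) i
        · exact zero_mem _
    intro g
    refine hle' (?_ : g ∈ _)
    rw [← Subgroup.closure_toSubmonoid_of_finite, hle]
    trivial
  · intro l hl lhat hlhat σ hσ g h h00 h01 h10 h11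
    obtain ⟨k, -, hk, hkσ⟩ := hζp.isPrimitiveRoot_iff.1 (hζp.map_of_injective σ.injective)
    have hσk : σ ζ = ζ ^ (k : ℤ) := by rw [zpow_natCast, hkσ]
    have hlk : (l : ZMod N) = (k : ℤ) := by
      rw [ZMod.intCast_eq_intCast_iff_dvd_sub, ← hζNp.zpow_eq_one_iff_dvd,
        zpow_sub₀ (hζNp.ne_zero hNpos.ne'), ← hσ, ← hmapN σ _ hσk, div_self]
      rw [hσ]
      exact zpow_ne_zero _ (hζNp.ne_zero hNpos.ne')
    let τ := diagConj hlhat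
    have hτ : h = τ g := Subtype.ext <| (eta_fin_two h.1).trans <| by
      change _ = !![g 0 0, l * g 0 1; lhat * g 1 0, g 1 1]
      rw [← h00, ← h01, ← h10, ← h11]
    rw [hτ]
    suffices (Units.map (σ.mapMatrix : Matrix I I ℂ →+* Matrix I I ℂ).toMonoidHom).comp ρ =
        D.comp (τ.comp f) by
      obtain ⟨m, rfl⟩ := hfs g
      rw [hD]
      exact congr_arg Units.val (DFunLike.congr_fun this m)
    refine MonoidHom.eq_of_eqOn_dense hgen ?_
    rintro x (rfl | rfl)
    · have hkn : IsCoprime (k : ℤ) (n : ℤ) := Nat.isCoprime_iff_coprime.2 hk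
      have hkN : IsCoprime (k : ℤ) ((N : ℤ) * N) := by
        have := hkn.of_isCoprime_of_dvd_right (Int.natCast_dvd_natCast.2 hNdvd)
        exact this.mul_right this
      obtain ⟨a, y, hay⟩ := hkN
      have hmdet : (!![a, N; -(N * y), k] : Matrix (Fin 2) (Fin 2) ℤ).det = 1 := by
        rw [det_fin_two_of]; linear_combination hay
      obtain ⟨m, hm⟩ : ∃ m : SL2Z, m.1 = !![a, N; -(N * y), k] := ⟨⟨_, hmdet⟩, rfl⟩
      have m11 : m 1 1 = k := by simp [hm]
      have hF := hFor' m (by simp [hm]) (by simp [hm])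
        (m11 ▸ hkn) σ (m11 ▸ hσk)
      have hSG := (hGal k hkn σ hσk).1
      have hGσ : (G k).map σ = G k := by
        ext p q
        rw [Matrix.map_apply, hG]
        obtain h | h := hε k hkn q <;> split_ifs <;> simp [h]
      rw [hSG, ← mul_assoc, hSS, one_mul, ← hGσ] at hF
      have hρm := hmap_inj σ hF
      have hτs : τ (f sM) = f (sM * m) := by
        refine Subtype.ext ?_
        have hal : (a : ZMod N) = lhat := by
          have h1 : (a : ZMod N) * l = 1 := by
            rw [hlk]
            simpa using congr_arg (Int.cast : ℤ → ZMod N) hay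
          calc (a : ZMod N) = a * (l * lhat) := by rw [hlhat, mul_one]
            _ = lhat := by rw [← mul_assoc, h1, one_mul]
        change !![((0 : ℤ) : ZMod N), l * ((-1 : ℤ) : ZMod N); lhat * ((1 : ℤ) : ZMod N),
          ((0 : ℤ) : ZMod N)] = (!![0, -1; 1, 0] * m.1).map (Int.cast : ℤ → ZMod N)
        rw [hm, ← hal, hlk]
        ext i j
        fin_cases i <;> fin_cases j <;> simp
      ext1
      change (ρ sM : Matrix I I ℂ).map σ = (D (τ (f sM)) : Matrix I I ℂ)
      rw [hτs, hD, map_mul, Units.val_mul, hρm, ← hSdef, hSG]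
    · have hτt : τ (f tM) = f (tM ^ (k : ℤ)) := by
        refine Subtype.ext ?_
        change !![((1 : ℤ) : ZMod N), l * ((1 : ℤ) : ZMod N); lhat * ((0 : ℤ) : ZMod N),
          ((1 : ℤ) : ZMod N)] = (tM ^ (k : ℤ)).1.map (Int.cast : ℤ → ZMod N)
        rw [htz, hlk]
        ext i j
        fin_cases i <;> fin_cases j <;> simp
      ext1
      change (ρ tM : Matrix I I ℂ).map σ = (D (τ (f tM)) : Matrix I I ℂ)
      rw [hτt, hD, map_zpow, ← hTz, ← hTdef, zpow_natCast, hTdiag', diagonal_pow,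
        diagonal_map (map_zero σ)]
      congr 1
      ext p
      obtain ⟨i, -, hi⟩ := hζNp.eq_pow_of_pow_eq_one (hTroot p)
      have := hmapN σ _ hσk
      rw [zpow_natCast] at this
      simp only [Pi.pow_apply, ← hi, map_pow, this, ← pow_mul, mul_comm]
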